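/- Let μ > 0, let X : ℝ → ℝ³ be twice continuously differentiable, let f : ℝ → ℝ³ be continuously differentiable, and let s ∈ ℝ with X'(s) ≠ 0; write τ̂ = X'(s)/‖X'(s)‖. For s' ≠ s with X(s') ≠ X(s), define g_D(s') = [ D(X(s), X(s')) f(s') − D₁(s, s') f(s) ] · |s'−s|³/(s'−s) (a vector in ℝ³, where · denotes scalar multiplication by |s'−s|³/(s'−s)). Then as s' → s through such values, g_D(s') converges to (1/(8πμ)) [ (1/(2‖X'(s)‖⁵)) ( −3( X'(s)X''(s)ᵀ + X''(s)X'(s)ᵀ ) − (X'(s)·X''(s)) (3I − 15 τ̂ τ̂ᵀ) ) f(s) + ( (I − 3 τ̂ τ̂ᵀ)/‖X'(s)‖³ ) f'(s) ]. -/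

import Mathlib

open Matrix

/-- Euclidean dot product on `ℝ³` (as `Fin 3 → ℝ`). -/
def dot3 (u v : Fin 3 → ℝ) : ℝ := ∑ i, u i * v i

/-- Euclidean norm on `ℝ³` (as `Fin 3 → ℝ`). -/
noncomputable def enorm3 (v : Fin 3 → ℝ) : ℝ := Real.sqrt (∑ i, v i ^ 2)

/-- The doublet kernel `D(x,y) = (1/(8πμ)) (I − 3 r̂ r̂ᵀ)/‖r‖³`, where `r = x − y`
and `r̂ = r/‖r‖`. -/
noncomputable def doublet (μ : ℝ) (x y : Fin 3 → ℝ) : Matrix (Fin 3) (Fin 3) ℝ :=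
  (1 / (8 * Real.pi * μ)) •
    ((enorm3 (x - y) ^ 3)⁻¹ •
      (1 - (3 : ℝ) •
        Matrix.vecMulVec ((enorm3 (x - y))⁻¹ • (x - y)) ((enorm3 (x - y))⁻¹ • (x - y))))

/-- The leading-order singularity of the doublet along the curve:
`D₁(s,s') = (1/(8πμ)) (I − 3 τ̂ τ̂ᵀ)/(‖X'(s)‖³ |s−s'|³)`, where `Xp = X'(s)` and
`τ̂ = Xp/‖Xp‖`. -/
noncomputable def doubletSing (μ : ℝ) (Xp : Fin 3 → ℝ) (s s' : ℝ) :
    Matrix (Fin 3) (Fin 3) ℝ :=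
  (1 / (8 * Real.pi * μ)) •
    ((enorm3 Xp ^ 3 * |s - s'| ^ 3)⁻¹ •
      (1 - (3 : ℝ) • Matrix.vecMulVec ((enorm3 Xp)⁻¹ • Xp) ((enorm3 Xp)⁻¹ • Xp)))

/-- The claimed limit of the subtracted doublet integrand:
`(1/(8πμ)) [ (1/(2‖X'‖⁵)) ( −3(X'X''ᵀ + X''X'ᵀ) − (X'·X'')(3I − 15τ̂τ̂ᵀ) ) f(s)
  + ((I − 3τ̂τ̂ᵀ)/‖X'‖³) f'(s) ]`, where `Xp = X'(s)`, `Xpp = X''(s)`,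
`fs = f(s)`, `fps = f'(s)`. -/
noncomputable def doubletLimit (μ : ℝ) (Xp Xpp fs fps : Fin 3 → ℝ) : Fin 3 → ℝ :=
  let th : Fin 3 → ℝ := (enorm3 Xp)⁻¹ • Xp
  (1 / (8 * Real.pi * μ)) •
    ((1 / (2 * enorm3 Xp ^ 5)) •
        ((-3 : ℝ) • (Matrix.vecMulVec Xp Xpp + Matrix.vecMulVec Xpp Xp)
          - dot3 Xp Xpp • ((3 : ℝ) • (1 : Matrix (Fin 3) (Fin 3) ℝ)
              - (15 : ℝ) • Matrix.vecMulVec th th)).mulVec fs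
      + ((enorm3 Xp ^ 3)⁻¹ • (1 - (3 : ℝ) • Matrix.vecMulVec th th)).mulVec fps)

/-- Scaled kernel applied to a vector. -/
noncomputable def kern (q v : Fin 3 → ℝ) : Fin 3 → ℝ :=
  ((enorm3 q ^ 3)⁻¹ • (1 - (3 : ℝ) •
    Matrix.vecMulVec ((enorm3 q)⁻¹ • q) ((enorm3 q)⁻¹ • q))).mulVec v

theorem kern_apply (q v : Fin 3 → ℝ) (i : Fin 3) :
    kern q v i = (enorm3 q)⁻¹ ^ 3 * v i - 3 * (enorm3 q)⁻¹ ^ 5 * q i * dot3 q v := by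
  unfold kern dot3
  generalize enorm3 q = N
  fin_cases i <;>
    simp [Matrix.mulVec, dotProduct, Fin.sum_univ_three, Matrix.vecMulVec_apply,
      Matrix.one_apply] <;> ring

theorem enorm3_smul (h : ℝ) (v : Fin 3 → ℝ) : enorm3 (h • v) = |h| * enorm3 v := by
  unfold enorm3
  rw [← Real.sqrt_sq_eq_abs, ← Real.sqrt_mul (sq_nonneg h), Finset.mul_sum]
  congr 1
  apply Finset.sum_congr rfl
  intro i _
  simp [mul_pow]

theorem enorm3_sum_pos {v : Fin 3 → ℝ} (hv : v ≠ 0) : 0 < ∑ i, v i ^ 2 := by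
  obtain ⟨i, hi⟩ := Function.ne_iff.mp hv
  exact Finset.sum_pos' (fun j _ => sq_nonneg _) ⟨i, Finset.mem_univ _, by
    have : v i ≠ 0 := hi
    positivity⟩

theorem hasDerivAt_dslope (X : ℝ → Fin 3 → ℝ) (hX : ContDiff ℝ 2 X) (s : ℝ) :
    HasDerivAt (dslope X s) ((1 / 2 : ℝ) • deriv (deriv X) s) s := by
  have h := taylor_tendsto (n := 2) convex_univ (Set.mem_univ s) hX.contDiffOn
  rw [nhdsWithin_univ] at h
  rw [hasDerivAt_iff_tendsto_slope]
  have h2 := (h.mono_left (nhdsWithin_le_nhds (s := {s}ᶜ))).add_const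
    ((1 / 2 : ℝ) • deriv (deriv X) s)
  rw [zero_add] at h2
  refine h2.congr' ?_
  filter_upwards [self_mem_nhdsWithin] with t ht
  have ht' : t - s ≠ 0 := sub_ne_zero.mpr ht
  have e2 : iteratedDeriv 2 X s = deriv (deriv X) s := by
    rw [iteratedDeriv_succ, iteratedDeriv_one]
  rw [slope_def_module, dslope_same, dslope_of_ne _ ht, slope_def_module]
  rw [taylorWithinEval_succ, taylorWithinEval_succ, taylor_within_zero_eval]
  simp only [iteratedDerivWithin_univ, Nat.reduceAdd, e2, zero_add, iteratedDeriv_one]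
  ext i
  simp
  field_simp
  ring

theorem kern_hasDerivAt (q v : ℝ → Fin 3 → ℝ) (q' v' : Fin 3 → ℝ) (s : ℝ)
    (hq : HasDerivAt q q' s) (hv : HasDerivAt v v' s) (h0 : q s ≠ 0) :
    HasDerivAt (fun t => kern (q t) (v t))
      ((1 / (enorm3 (q s) ^ 5)) •
        ((-3 : ℝ) • (Matrix.vecMulVec (q s) q' + Matrix.vecMulVec q' (q s))
          - dot3 (q s) q' • ((3 : ℝ) • (1 : Matrix (Fin 3) (Fin 3) ℝ)
              - (15 : ℝ) • Matrix.vecMulVec ((enorm3 (q s))⁻¹ • q s)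
                ((enorm3 (q s))⁻¹ • q s))).mulVec (v s)
      + kern (q s) v') s := by
  have hS := enorm3_sum_pos h0
  have hN : 0 < enorm3 (q s) := Real.sqrt_pos.mpr hS
  rw [hasDerivAt_pi] at hq hv ⊢
  have hNd : HasDerivAt (fun t => enorm3 (q t)) (dot3 (q s) q' / enorm3 (q s)) s := by
    have h1 : HasDerivAt (fun t => ∑ i, q t i ^ 2) (2 * dot3 (q s) q') s := by
      have := HasDerivAt.fun_sum (u := Finset.univ) (fun i _ => (hq i).fun_pow 2)
      refine this.congr_deriv ?_
      simp only [dot3, Finset.mul_sum]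
      apply Finset.sum_congr rfl
      intro i _
      simp
      ring
    have := h1.sqrt hS.ne'
    refine this.congr_deriv ?_
    unfold enorm3
    field_simp
  have hI := hNd.fun_inv hN.ne'
  have hdot : HasDerivAt (fun t => dot3 (q t) (v t)) (dot3 q' (v s) + dot3 (q s) v') s := by
    have := HasDerivAt.fun_sum (u := Finset.univ) (fun i _ => (hq i).fun_mul (hv i))
    refine this.congr_deriv ?_
    simp only [dot3, Finset.sum_add_distrib]
  intro i
  simp only [kern_apply, Pi.add_apply]
  have := ((hI.fun_pow 3).fun_mul (hv i)).fun_sub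
    ((((hI.fun_pow 5).const_mul 3).fun_mul (hq i)).fun_mul hdot)
  refine this.congr_deriv ?_
  generalize enorm3 (q s) = N at *
  have e : ∀ a b c d : Fin 3 → ℝ, (Matrix.vecMulVec a b).mulVec c = dot3 b c • a := by
    intro a b c d
    ext j
    simp [Matrix.mulVec, dotProduct, Matrix.vecMulVec_apply, dot3, Fin.sum_univ_three]
    ring
  have e3 : dot3 (N⁻¹ • q s) (v s) = N⁻¹ * dot3 (q s) (v s) := by
    simp [dot3, Fin.sum_univ_three]; ring
  simp only [Matrix.smul_mulVec, Matrix.sub_mulVec, Matrix.add_mulVec, Matrix.one_mulVec,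
    e _ _ _ 0, e3, Pi.smul_apply, Pi.add_apply, Pi.sub_apply, smul_eq_mul]
  push_cast
  field_simp
  ring

/-- The subtracted doublet integrand
`g_D(s') = [D(X(s),X(s')) f(s') − D₁(s,s') f(s)] · |s'−s|³/(s'−s)` extends
continuously to `s' = s`, with the stated limit. -/
theorem subtracted_doublet_integrand_limit (μ : ℝ) (hμ : 0 < μ)
    (X f : ℝ → Fin 3 → ℝ) (hX : ContDiff ℝ 2 X) (hf : ContDiff ℝ 1 f)
    (s : ℝ) (hXp : deriv X s ≠ 0) :
    Filter.Tendsto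
      (fun s' : ℝ => (|s' - s| ^ 3 / (s' - s)) •
        ((doublet μ (X s) (X s')).mulVec (f s')
          - (doubletSing μ (deriv X s) s s').mulVec (f s)))
      (nhdsWithin s {s' | s' ≠ s ∧ X s' ≠ X s})
      (nhds (doubletLimit μ (deriv X s) (deriv (deriv X) s) (f s) (deriv f s))) := by
  have hdX : HasDerivAt (dslope X s) _ s := hasDerivAt_dslope X hX s
  have hdf : HasDerivAt f (deriv f s) s :=
    (hf.differentiable (by norm_num) s).hasDerivAt
  have hk := kern_hasDerivAt (dslope X s) f _ _ s hdX hdf (by rwa [dslope_same])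
  rw [dslope_same, hasDerivAt_iff_tendsto_slope] at hk
  have hk2 := (hk.mono_left (nhdsWithin_mono s
    (show {s' | s' ≠ s ∧ X s' ≠ X s} ⊆ {s}ᶜ from fun t ht => ht.1))).const_smul
      (1 / (8 * Real.pi * μ))
  have hlim : doubletLimit μ (deriv X s) (deriv (deriv X) s) (f s) (deriv f s)
      = (1 / (8 * Real.pi * μ)) • ((1 / (enorm3 (deriv X s) ^ 5)) •
        ((-3 : ℝ) • (Matrix.vecMulVec (deriv X s) ((1 / 2 : ℝ) • deriv (deriv X) s)
            + Matrix.vecMulVec ((1 / 2 : ℝ) • deriv (deriv X) s) (deriv X s))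
          - dot3 (deriv X s) ((1 / 2 : ℝ) • deriv (deriv X) s) •
            ((3 : ℝ) • (1 : Matrix (Fin 3) (Fin 3) ℝ)
              - (15 : ℝ) • Matrix.vecMulVec ((enorm3 (deriv X s))⁻¹ • deriv X s)
                ((enorm3 (deriv X s))⁻¹ • deriv X s))).mulVec (f s)
      + kern (deriv X s) (deriv f s)) := by
    unfold doubletLimit kern
    have e : dot3 (deriv X s) ((1 / 2 : ℝ) • deriv (deriv X) s)
        = (1 / 2) * dot3 (deriv X s) (deriv (deriv X) s) := by
      simp [dot3, Fin.sum_univ_three]; ring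
    have e2 : (1 / (2 * enorm3 (deriv X s) ^ 5)) = (1 / enorm3 (deriv X s) ^ 5) * (1 / 2) := by
      ring
    simp only
    rw [e, e2, mul_smul, mul_smul, ← Matrix.smul_mulVec (1 / 2 : ℝ), smul_sub (1 / 2 : ℝ),
      smul_comm (1 / 2 : ℝ) (-3 : ℝ), smul_add (1 / 2 : ℝ), Matrix.vecMulVec_smul (1 / 2 : ℝ),
      Matrix.smul_vecMulVec (1 / 2 : ℝ)]
  rw [hlim]
  refine hk2.congr' ?_
  filter_upwards [self_mem_nhdsWithin] with t ht
  obtain ⟨ht, -⟩ := ht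
  have ht' : t - s ≠ 0 := sub_ne_zero.mpr ht
  have hD : (doublet μ (X s) (X t)).mulVec (f t)
      = (1 / (8 * Real.pi * μ)) • kern (X s - X t) (f t) := by
    unfold kern; rw [← Matrix.smul_mulVec]; rfl
  have hDs : (doubletSing μ (deriv X s) s t).mulVec (f s)
      = (1 / (8 * Real.pi * μ)) • ((|t - s| ^ 3)⁻¹ • kern (deriv X s) (f s)) := by
    unfold doubletSing kern
    rw [← Matrix.smul_mulVec, ← Matrix.smul_mulVec, smul_smul (|t - s| ^ 3)⁻¹, mul_inv,
      mul_comm (enorm3 (deriv X s) ^ 3)⁻¹, abs_sub_comm]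
  have hr : X s - X t = (-(t - s)) • dslope X s t := by
    rw [neg_smul, sub_smul_dslope, neg_sub]
  have hks : kern (X s - X t) (f t) = (|t - s| ^ 3)⁻¹ • kern (dslope X s t) (f t) := by
    rw [hr]
    ext i
    have e3 : dot3 ((-(t - s)) • dslope X s t) (f t) = (-(t - s)) * dot3 (dslope X s t) (f t) := by
      simp [dot3, Fin.sum_univ_three]; ring
    rw [Pi.smul_apply, kern_apply, kern_apply, enorm3_smul, e3, abs_neg]
    simp only [Pi.smul_apply, smul_eq_mul]
    have e4 : (t - s) ^ 2 = |t - s| ^ 2 := (sq_abs _).symm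
    have hA : |t - s| ≠ 0 := abs_ne_zero.mpr ht'
    have e5 : |t - s|⁻¹ ^ 5 * (t - s) ^ 2 = |t - s|⁻¹ ^ 3 := by
      rw [e4]; field_simp
    rw [mul_inv, mul_pow, mul_pow, ← inv_pow]
    linear_combination (-3 * (enorm3 (dslope X s t))⁻¹ ^ 5 * dslope X s t i *
      dot3 (dslope X s t) (f t)) * e5
  rw [hD, hDs, hks, slope_def_module, dslope_same]
  ext i
  simp only [Pi.smul_apply, Pi.sub_apply, smul_eq_mul]
  have hA : |t - s| ≠ 0 := abs_ne_zero.mpr ht'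
  field_simp
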